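/- Let p be an odd prime and G a group of order p⁵ having a subgroup of order p not contained in the center Z(G), whose Frattini subgroup Φ(G) has order p², and suppose it is not the case that Φ(G) = G′ = Z(G) with Z(G) isomorphic to C_p × C_p. Then the transiso graph Γ_p(G) is not complete, i.e., there exist two distinct subgroups of G of order p that admit no pair of isomorphic NRTs. -/

import Mathlib

/-- `S` is a normalized right transversal (NRT) of `H` in `G`: `1 ∈ S` and every `g ∈ G`
is uniquely `h * s` with `h ∈ H`, `s ∈ S`. -/
def IsNRT {G : Type*} [Group G] (H : Subgroup G) (S : Set G) : Prop :=
  (1 : G) ∈ S ∧ ∀ g : G, ∃! s, s ∈ S ∧ ∃ h ∈ H, g = h * s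

/-- `φ` is an isomorphism of NRTs from `S₁` (an NRT of `H₁`) onto `S₂` (an NRT of `H₂`):
it is a bijection from `S₁` to `S₂` carrying the induced operation of `S₁` to that of `S₂`,
where `z = x ∘ y` in `S` means `z ∈ S` and `x * y ∈ H * z`. -/
def IsNRTIso {G : Type*} [Group G] (H₁ H₂ : Subgroup G) (S₁ S₂ : Set G) (φ : G → G) : Prop :=
  Set.BijOn φ S₁ S₂ ∧
    ∀ x ∈ S₁, ∀ y ∈ S₁, ∀ z ∈ S₁, (∃ h ∈ H₁, x * y = h * z) →
      ∃ h ∈ H₂, φ x * φ y = h * φ z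

/-- Two subgroups are adjacent in the transiso graph if they admit isomorphic NRTs. -/
def TransisoAdj {G : Type*} [Group G] (H₁ H₂ : Subgroup G) : Prop :=
  ∃ S₁ S₂ : Set G, IsNRT H₁ S₁ ∧ IsNRT H₂ S₂ ∧ ∃ φ : G → G, IsNRTIso H₁ H₂ S₁ S₂ φ

/-- The transiso graph `Γ_d(G)` is complete: any two distinct subgroups of order `d`
are adjacent. -/
def TransisoComplete (G : Type*) [Group G] (d : ℕ) : Prop :=
  ∀ H₁ H₂ : Subgroup G, Nat.card H₁ = d → Nat.card H₂ = d → H₁ ≠ H₂ →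
    TransisoAdj H₁ H₂

open Subgroup
open scoped commutatorElement

section Transversal

variable {G : Type*} [Group G]

theorem IsNRT.eq_of_mul_inv_mem {H : Subgroup G} {S : Set G} (hS : IsNRT H S) {s t : G}
    (hs : s ∈ S) (ht : t ∈ S) (h : s * t⁻¹ ∈ H) : s = t :=
  (hS.2 s).unique ⟨hs, 1, H.one_mem, (one_mul s).symm⟩ ⟨ht, _, h, by group⟩

/-- If `H` contains no nontrivial normal subgroup and is adjacent to a normal subgroup `K`,
then `H` has a complement which is a homomorphic image of `G` with kernel `K`. -/
theorem TransisoAdj.exists_hom {K H : Subgroup G} [K.Normal] (hH : H.normalCore = ⊥)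
    (hKH : TransisoAdj K H) :
    ∃ f : G →* G, f.ker = K ∧ f.range ⊓ H = ⊥ ∧ ∀ g, ∃ h ∈ H, ∃ x, g = h * f x := by
  obtain ⟨S₁, S₂, h₁, h₂, φ, hφ, hmul⟩ := hKH
  choose r hr using fun g => (h₁.2 g).exists
  choose hrS k hk hrk using hr
  have hadj : ∀ x y, φ (r x) * φ (r y) * (φ (r (x * y)))⁻¹ ∈ H := by
    intro x y
    have hKmem : r x * r y * (r (x * y))⁻¹ ∈ K := by
      have hxy : r x * r y * (r (x * y))⁻¹ =
          (k x)⁻¹ * (x * (k y)⁻¹ * x⁻¹) * k (x * y) := by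
        have e1 : r x = (k x)⁻¹ * x := eq_inv_mul_of_mul_eq (hrk x).symm
        have e2 : r y = (k y)⁻¹ * y := eq_inv_mul_of_mul_eq (hrk y).symm
        have e3 : r (x * y) = (k (x * y))⁻¹ * (x * y) := eq_inv_mul_of_mul_eq (hrk _).symm
        rw [e1, e2, e3]; group
      rw [hxy]
      exact mul_mem (mul_mem (inv_mem (hk x))
        (‹K.Normal›.conj_mem _ (inv_mem (hk y)) x)) (hk _)
    obtain ⟨h, hh, e⟩ := hmul _ (hrS x) _ (hrS y) _ (hrS (x * y)) ⟨_, hKmem, by group⟩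
    rw [e]; simpa using hh
  have hcover : ∀ g, ∃ h ∈ H, ∃ x, g = h * φ (r x) := by
    intro g
    obtain ⟨s, ⟨hs, h, hh, e⟩, -⟩ := h₂.2 g
    obtain ⟨t, ht, rfl⟩ := hφ.surjOn hs
    refine ⟨h, hh, t, ?_⟩
    rwa [h₁.eq_of_mul_inv_mem (hrS t) ht]
    rw [eq_inv_mul_of_mul_eq (hrk t).symm]
    simpa using hk t
  have hone : ∀ x y, φ (r x) * φ (r y) = φ (r (x * y)) := by
    intro x y
    have hcore : φ (r x) * φ (r y) * (φ (r (x * y)))⁻¹ ∈ H.normalCore := by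
      intro g
      obtain ⟨h, hh, z, rfl⟩ := hcover g
      have a := hadj z x
      have b := hadj (z * x) y
      have c := hadj z (x * y)
      rw [← mul_assoc] at c
      have e := mul_mem (mul_mem hh (mul_mem (mul_mem a b) (inv_mem c))) (inv_mem hh)
      convert e using 1
      group
    rw [hH, mem_bot] at hcore
    exact mul_inv_eq_one.mp hcore
  refine ⟨MonoidHom.mk' (fun x => φ (r x)) fun x y => (hone x y).symm, ?_, ?_, hcover⟩
  · have h1 : φ (r 1) = 1 := by simpa using hone 1 1
    have r1 : r 1 = 1 := h₁.eq_of_mul_inv_mem (hrS 1) h₁.1 (by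
      have := hk 1
      rw [eq_inv_mul_of_mul_eq (hrk 1).symm]
      simpa using this)
    ext x
    simp only [MonoidHom.mem_ker, MonoidHom.mk'_apply]
    constructor
    · intro hx
      have := hφ.injOn (hrS x) (hrS 1) (hx.trans h1.symm)
      have hx := hrk x
      rw [this, r1, mul_one] at hx
      exact hx ▸ hk x
    · intro hx
      rw [← h1]
      congr 1
      apply h₁.eq_of_mul_inv_mem (hrS x) (hrS 1)
      rw [r1, eq_inv_mul_of_mul_eq (hrk x).symm]
      simpa using mul_mem (inv_mem (hk x)) hx
  · rw [eq_bot_iff]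
    rintro _ ⟨⟨x, rfl⟩, hx⟩
    exact h₂.eq_of_mul_inv_mem (hφ.mapsTo (hrS x)) h₂.1 (by simpa using hx)

/-- Adjacency preserves commutativity of the quotients by normal subgroups. -/
theorem TransisoAdj.commutator_le {K L : Subgroup G} [L.Normal] (hKL : TransisoAdj K L)
    (hK : commutator G ≤ K) : commutator G ≤ L := by
  obtain ⟨S₁, S₂, h₁, h₂, φ, hφ, hmul⟩ := hKL
  rw [← Normal.quotient_commutative_iff_commutator_le, isMulCommutative_iff]
  have hcover : ∀ q : G ⧸ L, ∃ x ∈ S₁, q = (φ x : G) := by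
    intro q
    induction q using QuotientGroup.induction_on with
    | H g =>
      obtain ⟨s, ⟨hs, h, hh, rfl⟩, -⟩ := h₂.2 g
      obtain ⟨t, ht, rfl⟩ := hφ.surjOn hs
      refine ⟨t, ht, ?_⟩
      rw [QuotientGroup.mk_mul, (QuotientGroup.eq_one_iff h).mpr hh, one_mul]
  intro a b
  obtain ⟨x, hx, rfl⟩ := hcover a
  obtain ⟨y, hy, rfl⟩ := hcover b
  obtain ⟨z, ⟨hz, k, hk, hxy⟩, -⟩ := h₁.2 (x * y)
  have hyx : y * x = (⁅y, x⁆ * k) * z := by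
    rw [mul_assoc, ← hxy, commutatorElement_def]; group
  obtain ⟨h, hh, e⟩ := hmul x hx y hy z hz ⟨k, hk, hxy⟩
  obtain ⟨h', hh', e'⟩ := hmul y hy x hx z hz
    ⟨_, mul_mem (hK (commutator_mem_commutator (mem_top y) (mem_top x))) hk, hyx⟩
  rw [← QuotientGroup.mk_mul, ← QuotientGroup.mk_mul, e, e', QuotientGroup.mk_mul,
    QuotientGroup.mk_mul, (QuotientGroup.eq_one_iff h).mpr hh,
    (QuotientGroup.eq_one_iff h').mpr hh']

end Transversal

theorem isCoatom_of_prime_index {G : Type*} [Group G] {M : Subgroup G} (hM : M.index.Prime) : IsCoatom M := by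
  refine ⟨fun h => by simp [h, Nat.not_prime_one] at hM, fun N hN => ?_⟩
  have h := relIndex_mul_index hN.le
  rcases (Nat.dvd_prime hM).mp (Dvd.intro_left _ h) with h1 | h1
  · exact index_eq_one.mp h1
  · rw [h1] at h
    have := Nat.eq_of_mul_eq_mul_right hM.pos (h.trans (one_mul _).symm)
    exact absurd (relIndex_eq_one.mp this) hN.not_ge

theorem Subgroup.normal_of_le_center {G : Type*} [Group G] {K : Subgroup G}
    (hK : K ≤ center G) : K.Normal :=
  ⟨fun k hk g => by rwa [mem_center_iff.mp (hK hk) g, mul_inv_cancel_right]⟩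

section PGroup

variable {G : Type*} [Group G] [Finite G] {p : ℕ} [Fact p.Prime]

theorem IsPGroup.le_center_of_card_eq_prime (hG : IsPGroup p G) {H : Subgroup G} [H.Normal]
    (hH : Nat.card H = p) : H ≤ center G := by
  obtain ⟨b, hb, hb1⟩ :=
    (hG.of_equiv (ConjAct.toConjAct (G := G))).exists_fixed_point_of_prime_dvd_card_of_fixed_point
      H hH.symm.dvd (a := 1) (fun g => smul_one g)
  have hbc : (b : G) ∈ center G := by
    rw [mem_center_iff]
    intro g
    have := congrArg Subtype.val (hb (ConjAct.toConjAct g))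
    rw [ConjAct.Subgroup.val_conj_smul, ConjAct.toConjAct_smul] at this
    exact mul_inv_eq_iff_eq_mul.mp this
  intro x hx
  have := mem_zpowers_of_prime_card hH (g := b) (g' := ⟨x, hx⟩) hb1.symm
  obtain ⟨n, hn⟩ := this
  have hn : (b : G) ^ n = x := congrArg Subtype.val hn
  exact hn ▸ zpow_mem hbc n

theorem IsPGroup.normalCore_eq_bot (hG : IsPGroup p G) {H : Subgroup G}
    (hH : Nat.card H = p) (hc : ¬ H ≤ center G) : H.normalCore = ⊥ := by
  have hd := card_dvd_of_le H.normalCore_le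
  rw [hH] at hd
  rcases (Nat.dvd_prime Fact.out).mp hd with h | h
  · exact card_eq_one.mp h
  · have e := eq_of_le_of_card_ge H.normalCore_le (hH.trans h.symm).le
    have : H.Normal := e ▸ H.normalCore_normal
    exact absurd (hG.le_center_of_card_eq_prime hH) hc

theorem IsPGroup.normal_and_index_of_isCoatom (hG : IsPGroup p G) {M : Subgroup G}
    (hM : IsCoatom M) : M.Normal ∧ M.index = p := by
  have := hG.isNilpotent
  have hn : M.Normal := Group.normalizerCondition_of_isNilpotent.normal_of_coatom M hM
  refine ⟨hn, ?_⟩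
  have hnt : Nontrivial (G ⧸ M) := QuotientGroup.nontrivial_iff.mpr hM.1
  have hQ := hG.to_quotient M
  obtain ⟨n, hn0, hn⟩ := hQ.nontrivial_iff_card.mp hnt
  obtain ⟨y, hy⟩ := exists_prime_orderOf_dvd_card' (G := G ⧸ M) p
    (hn ▸ dvd_pow_self p hn0.ne')
  have hlt : M < (zpowers y).comap (QuotientGroup.mk' M) := by
    refine lt_of_le_of_ne (fun m hm => ?_) fun h => ?_
    · rw [mem_comap, QuotientGroup.mk'_apply, (QuotientGroup.eq_one_iff m).mpr hm]
      exact one_mem _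
    · obtain ⟨g, rfl⟩ := QuotientGroup.mk_surjective y
      have hg : g ∈ M := by
        rw [h]; exact mem_zpowers _
      rw [(QuotientGroup.eq_one_iff g).mpr hg, orderOf_one] at hy
      exact (Fact.out : p.Prime).one_lt.ne hy
  have htop := hM.2 _ hlt
  have : zpowers y = ⊤ := by
    rw [eq_top_iff]
    intro q _
    obtain ⟨g, rfl⟩ := QuotientGroup.mk_surjective q
    have : g ∈ (zpowers y).comap (QuotientGroup.mk' M) := htop ▸ mem_top g
    exact this
  rw [index_eq_card, ← hy, ← Nat.card_zpowers, this, card_top]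

theorem IsPGroup.commutator_le_frattini (hG : IsPGroup p G) : commutator G ≤ frattini G := by
  refine le_iInf₂ fun M hM => ?_
  obtain ⟨hn, hi⟩ := hG.normal_and_index_of_isCoatom hM
  rw [← Normal.quotient_commutative_iff_commutator_le]
  have : IsCyclic (G ⧸ M) := isCyclic_of_prime_card (p := p) hi
  exact this.isMulCommutative

theorem IsPGroup.pow_mem_frattini (hG : IsPGroup p G) (g : G) : g ^ p ∈ frattini G := by
  simp only [frattini, Order.radical, mem_iInf]
  intro M hM
  obtain ⟨hn, hi⟩ := hG.normal_and_index_of_isCoatom hM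
  rw [← hi]
  exact M.pow_index_mem g

theorem IsPGroup.mul_card_le_of_lt (hG : IsPGroup p G) {H K : Subgroup G} (h : H < K) :
    p * Nat.card H ≤ Nat.card K := by
  obtain ⟨n, hn⟩ := (hG.to_subgroup K).index (H.subgroupOf K)
  have hn0 : n ≠ 0 := by
    rintro rfl
    exact h.not_ge (subgroupOf_eq_top.mp (index_eq_one.mp (hn.trans (pow_zero p))))
  rw [← (H.subgroupOf K).card_mul_index, hn, mul_comm,
    Nat.card_congr (subgroupOfEquivOfLe h.le).toEquiv]
  exact Nat.mul_le_mul_left _ (Nat.le_of_dvd (pow_pos (Fact.out : p.Prime).pos n)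
    (dvd_pow_self p hn0))

end PGroup

theorem mul_pow_eq_of_mul_eq {G : Type*} [Group G] {a b c : G} (hba : b * a = a * b * c)
    (ha : Commute c a) (hb : Commute c b) (n : ℕ) :
    (a * b) ^ n = a ^ n * b ^ n * c ^ n.choose 2 := by
  have hb' : ∀ n, b ^ n * a = a * b ^ n * c ^ n := by
    intro n
    induction n with
    | zero => simp
    | succ n ih =>
      rw [pow_succ, mul_assoc, hba, ← mul_assoc, ← mul_assoc, ih,
        mul_assoc _ (c ^ n) b, (hb.pow_left n).eq, pow_succ c]
      simp only [mul_assoc]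
  induction n with
  | zero => simp
  | succ n ih =>
    rw [pow_succ, ih, Nat.choose_succ_succ' n 1, Nat.choose_one_right, pow_add c,
      ← mul_assoc, mul_assoc _ _ a, (ha.pow_left _).eq, ← mul_assoc, mul_assoc _ _ a, hb' n,
      mul_assoc _ _ b, (hb.pow_left _).eq]
    rw [← mul_assoc (a ^ n), ← mul_assoc (a ^ n), ← pow_succ, mul_assoc _ (c ^ n),
      ← mul_assoc (c ^ n), (hb.pow_left n).eq, pow_succ b]
    simp only [mul_assoc]

theorem nonempty_addEquiv_of_card_eq_sq {V : Type*} [AddCommGroup V] {p : ℕ} [Fact p.Prime]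
    [Module (ZMod p) V] (hc : Nat.card V = p ^ 2) : Nonempty (V ≃+ ZMod p × ZMod p) := by
  have : Finite V := Nat.finite_of_card_ne_zero (by rw [hc]; exact pow_ne_zero _ (NeZero.ne p))
  have : Module.Finite (ZMod p) V := Module.Finite.of_finite
  have hcard : p ^ 2 = p ^ Module.finrank (ZMod p) V := by
    rw [← hc, Module.natCard_eq_pow_finrank (K := ZMod p) (V := V), Nat.card_zmod]
  have hf : Module.finrank (ZMod p) V = Module.finrank (ZMod p) (ZMod p × ZMod p) := by
    simp [← Nat.pow_right_injective (Fact.out : p.Prime).two_le hcard]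
  obtain ⟨e⟩ := FiniteDimensional.nonempty_linearEquiv_of_finrank_eq hf
  exact ⟨e.toAddEquiv⟩

theorem nonempty_mulEquiv_of_card_eq_sq {A : Type*} [Group A] {p : ℕ} [Fact p.Prime]
    (hc : Nat.card A = p ^ 2) (he : ∀ a : A, a ^ p = 1) :
    Nonempty (A ≃* Multiplicative (ZMod p) × Multiplicative (ZMod p)) := by
  let : CommGroup A := IsPGroup.commGroupOfCardEqPrimeSq hc
  let : Module (ZMod p) (Additive A) := AddCommGroup.zmodModule (G := Additive A) he
  obtain ⟨e⟩ := nonempty_addEquiv_of_card_eq_sq (V := Additive A) hc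
  exact ⟨(AddEquiv.toMultiplicativeRight e).trans (MulEquiv.prodMultiplicative _ _)⟩

section Main

variable {G : Type*} [Group G] [Finite G] {p : ℕ} [Fact p.Prime]

theorem TransisoComplete.exists_hom (hG : IsPGroup p G) (hT : TransisoComplete G p)
    {K H : Subgroup G} (hK : Nat.card K = p) (hH : Nat.card H = p) (hKc : K ≤ center G)
    (hHc : ¬ H ≤ center G) :
    ∃ f : G →* G, f.ker = K ∧ f.range ⊓ H = ⊥ ∧ (∀ g, ∃ h ∈ H, ∃ x, g = h * f x) ∧
      frattini G ≤ f.range := by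
  have hKn : K.Normal := normal_of_le_center hKc
  obtain ⟨f, hf, hd, hc⟩ := (hT K H hK hH (by rintro rfl; exact hHc hKc)).exists_hom
    (hG.normalCore_eq_bot hH hHc)
  refine ⟨f, hf, hd, hc, frattini_le_coatom (isCoatom_of_prime_index ?_)⟩
  have h1 := f.range.card_mul_index
  rw [← index_ker, hf, ← K.card_mul_index, hK, mul_comm] at h1
  rw [Nat.eq_of_mul_eq_mul_right (Nat.pos_of_ne_zero index_ne_zero_of_finite) h1]
  exact Fact.out

theorem TransisoComplete.le_center_of_le_frattini (hG : IsPGroup p G) [Nontrivial G]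
    (hT : TransisoComplete G p) {L : Subgroup G} (hL : Nat.card L = p) (hLΦ : L ≤ frattini G) :
    L ≤ center G := by
  by_contra hLc
  have := hG.center_nontrivial
  obtain ⟨n, hn0, hn⟩ := (hG.to_subgroup (center G)).nontrivial_iff_card.mp this
  obtain ⟨z, hz⟩ := exists_prime_orderOf_dvd_card' (G := center G) p (hn ▸ dvd_pow_self p hn0.ne')
  obtain ⟨f, -, hd, -, hΦ⟩ := hT.exists_hom hG (K := zpowers (z : G)) (by
    rw [Nat.card_zpowers, orderOf_coe, hz]) hL (by simp) hLc
  rw [inf_eq_right.mpr (hLΦ.trans hΦ)] at hd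
  rw [hd, card_bot] at hL
  exact (Fact.out : p.Prime).one_lt.ne hL

/-- The Frattini subgroup has exponent dividing `p`. -/
theorem TransisoComplete.pow_eq_one_of_mem_frattini (hG : IsPGroup p G) [Nontrivial G]
    (hodd : Odd p) (hT : TransisoComplete G p) (hΦ : Nat.card (frattini G) = p ^ 2)
    {H : Subgroup G} (hH : Nat.card H = p) (hHc : ¬ H ≤ center G) {g : G}
    (hg : g ∈ frattini G) : g ^ p = 1 := by
  by_contra hgp
  have hpp : p.Prime := Fact.out
  have hord : orderOf g = p ^ 2 := by
    have h2 : g ^ p ^ 2 = 1 := by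
      have := pow_card_eq_one' (x := (⟨g, hg⟩ : frattini G))
      rw [hΦ] at this
      exact congrArg Subtype.val this
    exact orderOf_eq_prime_pow (n := 1) (by simpa using hgp) h2
  have hordp : orderOf (g ^ p) = p := by
    rw [orderOf_pow_of_dvd hpp.ne_zero (hord ▸ dvd_pow_self p two_ne_zero), hord, sq,
      Nat.mul_div_cancel _ hpp.pos]
  have hKcard : Nat.card (zpowers (g ^ p)) = p := by rw [Nat.card_zpowers, hordp]
  have hKΦ : zpowers (g ^ p) ≤ frattini G := zpowers_le.mpr (pow_mem hg p)
  have hKc := hT.le_center_of_le_frattini hG hKcard hKΦ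
  obtain ⟨f, hker, hd, hcov, hΦf⟩ := hT.exists_hom hG hKcard hH hKc hHc
  have hmapcard : Nat.card ((frattini G).map f) = p := by
    have h1 := (f.ker.subgroupOf (frattini G)).card_mul_index
    rw [← relIndex, relIndex_ker, hker, hΦ, Nat.card_congr (subgroupOfEquivOfLe hKΦ).toEquiv,
      hKcard, sq] at h1
    exact Nat.eq_of_mul_eq_mul_left hpp.pos h1
  have hmap : zpowers (g ^ p) = (frattini G).map f := by
    refine eq_of_le_of_card_ge (zpowers_le.mpr ?_) (hmapcard.trans hKcard.symm).le
    obtain ⟨x, rfl⟩ := hΦf hg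
    exact ⟨x ^ p, hG.pow_mem_frattini x, map_pow f x p⟩
  have hfp : ∀ x, f x ^ p ∈ f.ker := fun x => by
    rw [hker, hmap, ← map_pow]
    exact mem_map_of_mem f (hG.pow_mem_frattini x)
  have hpow : ∀ x, x ^ p ∈ f.ker := by
    intro x
    obtain ⟨h, hh, y, rfl⟩ := hcov x
    have hcomm : ⁅(f (f y))⁻¹, (f h)⁻¹⁆ ∈ zpowers (g ^ p) := by
      rw [hmap, ← map_inv f (f y), ← map_inv f h, ← map_commutatorElement]
      exact mem_map_of_mem f (hG.commutator_le_frattini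
        (commutator_mem_commutator (mem_top _) (mem_top _)))
    have hcen := mem_center_iff.mp (hKc hcomm)
    have hone : ⁅(f (f y))⁻¹, (f h)⁻¹⁆ ^ p = 1 := by
      have := pow_card_eq_one' (x := (⟨_, hcomm⟩ : zpowers (g ^ p)))
      rw [hKcard] at this
      exact congrArg Subtype.val this
    have hh1 : h ^ p = 1 := by
      have := pow_card_eq_one' (x := (⟨h, hh⟩ : H))
      rw [hH] at this
      exact congrArg Subtype.val this
    rw [MonoidHom.mem_ker, map_pow, map_mul,
      mul_pow_eq_of_mul_eq (c := ⁅(f (f y))⁻¹, (f h)⁻¹⁆) (by rw [commutatorElement_def]; group)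
        (hcen _).symm (hcen _).symm, ← map_pow, ← map_pow, hh1, MonoidHom.mem_ker.mp (hfp y),
      Nat.choose_two_right]
    obtain ⟨k, hk⟩ := hodd
    have : p * (p - 1) / 2 = p * k := by
      rw [show p - 1 = k * 2 by lia, ← mul_assoc, Nat.mul_div_cancel _ two_pos]
    rw [this, pow_mul, hone]
    simp
  obtain ⟨x, rfl⟩ := hΦf hg
  exact hgp (by rw [← map_pow]; exact hpow x)

/-- If the center has index at most `p ^ 2` and contains the commutator subgroup, then the latter
is cyclic. -/
theorem IsPGroup.exists_commutator_le_zpowers (hG : IsPGroup p G)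
    (hc : Nat.card G ≤ p ^ 2 * Nat.card (center G)) (h2 : commutator G ≤ center G) :
    ∃ a b : G, commutator G ≤ zpowers ⁅a, b⁆ := by
  by_cases hab : ∀ a b : G, a * b = b * a
  · refine ⟨1, 1, ?_⟩
    rw [commutator_def, Subgroup.commutator_le]
    intro x _ y _
    rw [commutatorElement_eq_one_iff_mul_comm.mpr (hab x y)]
    exact one_mem _
  push Not at hab
  obtain ⟨a, b, hab⟩ := hab
  refine ⟨a, b, ?_⟩
  have hCc : zpowers ⁅a, b⁆ ≤ center G := zpowers_le.mpr
    (h2 (commutator_mem_commutator (mem_top _) (mem_top _)))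
  have : (zpowers ⁅a, b⁆).Normal := normal_of_le_center hCc
  let π := QuotientGroup.mk' (zpowers ⁅a, b⁆)
  have hcen : ∀ z ∈ center G, ∀ q, π z * q = q * π z := by
    intro z hz q
    obtain ⟨g, rfl⟩ := QuotientGroup.mk'_surjective _ q
    rw [← map_mul, ← map_mul, mem_center_iff.mp hz g]
  have hπ : π a * π b = π b * π a := by
    rw [← commutatorElement_eq_one_iff_mul_comm, ← map_commutatorElement]
    exact (QuotientGroup.eq_one_iff _).mpr (mem_zpowers _)
  have htop : ∀ U : Subgroup G, center G ≤ U → a ∈ U → b ∈ U → U = ⊤ := by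
    intro U hz ha hb
    have h1 : center G < center G ⊔ zpowers a := by
      refine left_lt_sup.mpr fun h => hab ?_
      exact (mem_center_iff.mp (h (mem_zpowers a)) b).symm
    have h2 : center G ⊔ zpowers a < U := by
      refine lt_of_le_of_ne (sup_le hz (zpowers_le.mpr ha)) fun h => hab ?_
      have : center G ⊔ zpowers a ≤ centralizer {a} :=
        sup_le (center_le_centralizer _)
          (zpowers_le.mpr (mem_centralizer_singleton_iff.mpr rfl))
      exact (mem_centralizer_singleton_iff.mp (this (h ▸ hb))).symm
    refine eq_top_of_le_card U (hc.trans ?_)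
    have e1 := hG.mul_card_le_of_lt h1
    have e2 := hG.mul_card_le_of_lt h2
    calc p ^ 2 * Nat.card (center G) = p * (p * Nat.card (center G)) := by ring
      _ ≤ _ := (Nat.mul_le_mul_left p e1).trans e2
  have hza : ∀ x, π a * π x = π x * π a := by
    intro x
    have := htop ((centralizer {π a}).comap π)
      (fun z hz => mem_centralizer_singleton_iff.mpr (hcen z hz _))
      (mem_centralizer_singleton_iff.mpr rfl) (mem_centralizer_singleton_iff.mpr hπ.symm)
    have hx : x ∈ (centralizer {π a}).comap π := this ▸ mem_top x
    exact (mem_centralizer_singleton_iff.mp hx).symm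
  have hzb : ∀ x, π b * π x = π x * π b := by
    intro x
    have := htop ((centralizer {π b}).comap π)
      (fun z hz => mem_centralizer_singleton_iff.mpr (hcen z hz _))
      (mem_centralizer_singleton_iff.mpr hπ) (mem_centralizer_singleton_iff.mpr rfl)
    have hx : x ∈ (centralizer {π b}).comap π := this ▸ mem_top x
    exact (mem_centralizer_singleton_iff.mp hx).symm
  rw [← Normal.quotient_commutative_iff_commutator_le, isMulCommutative_iff]
  intro q r
  obtain ⟨x, rfl⟩ := QuotientGroup.mk'_surjective _ q
  obtain ⟨y, rfl⟩ := QuotientGroup.mk'_surjective _ r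
  have := htop ((centralizer {π y}).comap π)
    (fun z hz => mem_centralizer_singleton_iff.mpr (hcen z hz _))
    (mem_centralizer_singleton_iff.mpr (hza y)) (mem_centralizer_singleton_iff.mpr (hzb y))
  have hx : x ∈ (centralizer {π y}).comap π := this ▸ mem_top x
  exact mem_centralizer_singleton_iff.mp hx

end Main

theorem stmt_19 {G : Type*} [Group G] (p : ℕ) (hp : p.Prime) (hodd : Odd p)
    (hcard : Nat.card G = p ^ 5)
    (hnc : ∃ H : Subgroup G, Nat.card H = p ∧ ¬ H ≤ Subgroup.center G)
    (hΦ : Nat.card (frattini G) = p ^ 2)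
    (hne : ¬ (frattini G = commutator G ∧ commutator G = Subgroup.center G ∧
      Nonempty ((Subgroup.center G) ≃*
        (Multiplicative (ZMod p) × Multiplicative (ZMod p))))) :
    ¬ TransisoComplete G p := by
  intro hT
  have : Fact p.Prime := ⟨hp⟩
  have : Finite G := Nat.finite_of_card_ne_zero (hcard ▸ pow_ne_zero _ hp.ne_zero)
  have hG : IsPGroup p G := IsPGroup.of_card hcard
  have : Nontrivial G := Finite.one_lt_card_iff_nontrivial.mp
    (hcard ▸ Nat.one_lt_pow (by norm_num) hp.one_lt)
  obtain ⟨H, hH, hHc⟩ := hnc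
  have hexp : ∀ g ∈ frattini G, g ^ p = 1 := fun g hg =>
    hT.pow_eq_one_of_mem_frattini hG hodd hΦ hH hHc hg
  have hcyc : ∀ g ∈ frattini G, g ≠ 1 → Nat.card (Subgroup.zpowers g) = p := fun g hg h1 => by
    rw [Nat.card_zpowers, orderOf_eq_prime (hexp g hg) h1]
  have hΦZ : frattini G ≤ Subgroup.center G := by
    intro g hg
    by_cases h1 : g = 1
    · exact h1 ▸ one_mem _
    · exact hT.le_center_of_le_frattini hG (hcyc g hg h1) (Subgroup.zpowers_le.mpr hg)
        (Subgroup.mem_zpowers g)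
  have hle := hG.commutator_le_frattini
  have hG1 : commutator G ≠ ⊥ := by
    intro h
    refine hHc fun x _ => Subgroup.mem_center_iff.mpr fun g => ?_
    rw [← commutatorElement_eq_one_iff_mul_comm, ← Subgroup.mem_bot, ← h]
    exact Subgroup.commutator_mem_commutator (Subgroup.mem_top _) (Subgroup.mem_top _)
  have hcomm : Nat.card (commutator G) ≠ p := by
    intro hc
    have hlt : commutator G < frattini G := lt_of_le_of_ne hle fun h => by
      rw [h, hΦ] at hc
      exact hp.one_lt.ne' (Nat.eq_of_mul_eq_mul_left hp.pos (by rw [← sq, hc, mul_one]))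
    obtain ⟨g, hg, hgc⟩ := SetLike.exists_of_lt hlt
    have hL := hcyc g hg fun h => hgc (h ▸ one_mem _)
    have : (Subgroup.zpowers g).Normal :=
      Subgroup.normal_of_le_center (Subgroup.zpowers_le.mpr (hΦZ hg))
    have hne : commutator G ≠ Subgroup.zpowers g := fun h => hgc (h ▸ Subgroup.mem_zpowers g)
    exact hne (Subgroup.eq_of_le_of_card_ge ((hT _ _ hc hL hne).commutator_le le_rfl)
      (hL.trans hc.symm).le)
  have heq : frattini G = commutator G := by
    obtain ⟨k, hk, hk'⟩ := (Nat.dvd_prime_pow hp).mp (hΦ ▸ Subgroup.card_dvd_of_le hle)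
    refine (Subgroup.eq_of_le_of_card_ge hle ?_).symm
    interval_cases k
    · exact absurd (Subgroup.card_eq_one.mp (hk'.trans (pow_zero p))) hG1
    · exact absurd (hk'.trans (pow_one p)) hcomm
    · rw [hΦ, hk']
  have hZ : commutator G = Subgroup.center G := by
    by_contra hne'
    have hlt := hG.mul_card_le_of_lt (lt_of_le_of_ne (hle.trans hΦZ) hne')
    rw [← heq, hΦ] at hlt
    obtain ⟨a, b, hab⟩ := hG.exists_commutator_le_zpowers (by
      rw [hcard]
      calc p ^ 5 = p ^ 2 * (p * p ^ 2) := by ring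
        _ ≤ _ := Nat.mul_le_mul_left _ hlt) (hle.trans hΦZ)
    have hc : ⁅a, b⁆ ^ p = 1 := hexp _ (hle
      (Subgroup.commutator_mem_commutator (Subgroup.mem_top _) (Subgroup.mem_top _)))
    have h1 := Nat.le_of_dvd Nat.card_pos (Subgroup.card_dvd_of_le hab)
    rw [← heq, hΦ, Nat.card_zpowers] at h1
    have h2 := h1.trans (orderOf_le_of_pow_eq_one hp.pos hc)
    have := hp.two_le
    nlinarith
  have hcZ : Nat.card (Subgroup.center G) = p ^ 2 := by rw [← hZ, ← heq, hΦ]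
  refine hne ⟨heq, hZ, nonempty_mulEquiv_of_card_eq_sq hcZ ?_⟩
  rintro ⟨z, hz⟩
  rw [← hZ, ← heq] at hz
  exact Subtype.ext (hexp z hz)
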